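/- Let K be an algebraically closed field of characteristic 0, let d ≥ 5, and let ℓ ≥ 2 be an integer dividing d. If F ∈ K[X,Y,Z] is a nonsingular homogeneous polynomial of degree d such that Aut(F) contains an element of order ℓ(d−1), then F is projectively equivalent to a polynomial of the form X^d + Y^d + α·X·Z^{d−1} + Σ_k β_k·X^{d−ℓk}·Y^{ℓk}, where α ∈ K^×, β_k ∈ K, and the sum ranges over integers k ≥ 1 with 2 ≤ ℓk ≤ d−2. In particular Aut(F) is cyclic. -/

import Mathlib

open MvPolynomial Matrix

noncomputable section

variable {K : Type*} [Field K]

/-- The substitution `F ∘ A`, i.e. `X i ↦ ∑ j, A i j • X j`. -/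
def substPoly (A : Matrix (Fin 3) (Fin 3) K) (F : MvPolynomial (Fin 3) K) :
    MvPolynomial (Fin 3) K :=
  aeval (fun i => ∑ j, A i j • X j) F

lemma substPoly_one (F : MvPolynomial (Fin 3) K) : substPoly 1 F = F := by
  have h : (fun i => ∑ j, (1 : Matrix (Fin 3) (Fin 3) K) i j • X j)
      = (X : Fin 3 → MvPolynomial (Fin 3) K) := by
    funext i
    simp [Matrix.one_apply, ite_smul]
  rw [substPoly, h]
  exact aeval_X_left_apply F

lemma substPoly_smul (A : Matrix (Fin 3) (Fin 3) K) (c : K) (F : MvPolynomial (Fin 3) K) :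
    substPoly A (c • F) = c • substPoly A F := by
  unfold substPoly
  exact _root_.map_smul (aeval fun i => ∑ j, A i j • X j) c F

lemma substPoly_mul (A B : Matrix (Fin 3) (Fin 3) K) (F : MvPolynomial (Fin 3) K) :
    substPoly (A * B) F = substPoly B (substPoly A F) := by
  have hfun : (fun i => ∑ j, (A * B) i j • (X j : MvPolynomial (Fin 3) K))
      = fun i => (aeval fun i => (∑ j, B i j • X j : MvPolynomial (Fin 3) K))
          (∑ j, A i j • X j : MvPolynomial (Fin 3) K) := by
    funext i
    rw [map_sum]
    simp only [_root_.map_smul, aeval_X, Matrix.mul_apply, Finset.sum_smul, Finset.smul_sum, smul_smul]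
    exact Finset.sum_comm
  have h1 : substPoly (A * B) F
      = aeval (fun i => (aeval fun i => (∑ j, B i j • X j : MvPolynomial (Fin 3) K))
          (∑ j, A i j • X j : MvPolynomial (Fin 3) K)) F := by
    unfold substPoly
    exact congrArg
      (fun f => (aeval f : MvPolynomial (Fin 3) K →ₐ[K] MvPolynomial (Fin 3) K) F) hfun
  rw [h1, ← MvPolynomial.comp_aeval]
  rfl

/-- The subgroup of `GL₃(K)` preserving the polynomial `F` up to scalar. -/
def autGL (F : MvPolynomial (Fin 3) K) : Subgroup (GL (Fin 3) K) where
  carrier := {A | ∃ c : Kˣ, substPoly (A : Matrix (Fin 3) (Fin 3) K) F = (c : K) • F}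
  one_mem' := ⟨1, by simp [substPoly_one]⟩
  mul_mem' := by
    rintro A B ⟨c, hc⟩ ⟨e, he⟩
    refine ⟨c * e, ?_⟩
    have hAB : ((A * B : GL (Fin 3) K) : Matrix (Fin 3) (Fin 3) K)
        = (A : Matrix (Fin 3) (Fin 3) K) * (B : Matrix (Fin 3) (Fin 3) K) := rfl
    rw [hAB, substPoly_mul, hc, substPoly_smul, he, smul_smul, ← Units.val_mul]
  inv_mem' := by
    rintro A ⟨c, hc⟩
    refine ⟨c⁻¹, ?_⟩
    have key : (c : K) • substPoly ((A⁻¹ : GL (Fin 3) K) : Matrix (Fin 3) (Fin 3) K) F = F := by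
      rw [← substPoly_smul, ← hc, ← substPoly_mul]
      have h1 : (A : Matrix (Fin 3) (Fin 3) K) *
          ((A⁻¹ : GL (Fin 3) K) : Matrix (Fin 3) (Fin 3) K) = 1 := by
        exact_mod_cast Units.mul_inv A
      rw [h1, substPoly_one]
    calc substPoly ((A⁻¹ : GL (Fin 3) K) : Matrix (Fin 3) (Fin 3) K) F
        = ((c : K)⁻¹ * (c : K)) •
            substPoly ((A⁻¹ : GL (Fin 3) K) : Matrix (Fin 3) (Fin 3) K) F := by
          rw [inv_mul_cancel₀ (Units.ne_zero c), one_smul]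
      _ = (c : K)⁻¹ • ((c : K) •
            substPoly ((A⁻¹ : GL (Fin 3) K) : Matrix (Fin 3) (Fin 3) K) F) := by
          rw [smul_smul]
      _ = (c : K)⁻¹ • F := by rw [key]
      _ = ((c⁻¹ : Kˣ) : K) • F := by rw [Units.val_inv_eq_inv_val]

/-- `PGL₃(K)`: the quotient of `GL₃(K)` by its center (the scalar matrices). -/
abbrev PGL3 (K : Type*) [Field K] := GL (Fin 3) K ⧸ Subgroup.center (GL (Fin 3) K)

/-- The automorphism group of the plane curve `F = 0`, as a subgroup of `PGL₃(K)`: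
the classes of matrices `A` with `F ∘ A = λ • F` for some `λ ∈ Kˣ`. -/
def projAut (F : MvPolynomial (Fin 3) K) : Subgroup (PGL3 K) :=
  (autGL F).map (QuotientGroup.mk' (Subgroup.center (GL (Fin 3) K)))

/-- `F` is nonsingular: the only common zero of its partial derivatives is the origin. -/
def IsNonsingular (F : MvPolynomial (Fin 3) K) : Prop :=
  ∀ x : Fin 3 → K, (∀ i, eval x (pderiv i F) = 0) → x = 0

/-- `F` and `G` are projectively equivalent: `F ∘ A = λ • G` for some `A ∈ GL₃(K)`, `λ ∈ Kˣ`. -/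
def ProjEquiv (F G : MvPolynomial (Fin 3) K) : Prop :=
  ∃ A : GL (Fin 3) K, ∃ c : Kˣ,
    substPoly (A : Matrix (Fin 3) (Fin 3) K) F = (c : K) • G



lemma eval_substPoly (A : Matrix (Fin 3) (Fin 3) K) (F : MvPolynomial (Fin 3) K)
    (x : Fin 3 → K) : eval x (substPoly A F) = eval (A *ᵥ x) F := by
  induction F using MvPolynomial.induction_on with
  | C a => simp [substPoly]
  | add p q hp hq =>
    have : substPoly A (p + q) = substPoly A p + substPoly A q := by simp [substPoly]
    rw [this, map_add, map_add, hp, hq]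
  | mul_X p i hp =>
    have : substPoly A (p * X i) = substPoly A p * ∑ j, A i j • X j := by simp [substPoly]
    rw [this, map_mul, map_mul, hp]
    simp [Matrix.mulVec, dotProduct, Algebra.smul_def]

/-- derivative of `F` at `x` in direction `q` -/
def dirD (F : MvPolynomial (Fin 3) K) (x q : Fin 3 → K) : K :=
  ∑ i, q i * eval x (pderiv i F)

lemma dirD_substPoly (A : Matrix (Fin 3) (Fin 3) K) (F : MvPolynomial (Fin 3) K)
    (x q : Fin 3 → K) : dirD (substPoly A F) x q = dirD F (A *ᵥ x) (A *ᵥ q) := by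
  induction F using MvPolynomial.induction_on with
  | C a => simp [substPoly, dirD, algebraMap_eq]
  | add p r hp hr =>
    have : substPoly A (p + r) = substPoly A p + substPoly A r := by simp [substPoly]
    rw [this]
    simp only [dirD, map_add, mul_add, Finset.sum_add_distrib] at *
    rw [hp, hr]
  | mul_X p i hp =>
    have : substPoly A (p * X i) = substPoly A p * ∑ j, A i j • X j := by simp [substPoly]
    rw [this]
    have e1 : dirD (substPoly A p * ∑ j, A i j • X j) x q =
        dirD (substPoly A p) x q * (A *ᵥ x) i + eval x (substPoly A p) * (A *ᵥ q) i := by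
      simp [dirD, Fin.sum_univ_three, Matrix.mulVec, dotProduct, pderiv_X,
        Pi.single_apply, smul_eq_C_mul]
      ring
    have e2 : dirD (p * X i) (A *ᵥ x) (A *ᵥ q) =
        dirD p (A *ᵥ x) (A *ᵥ q) * (A *ᵥ x) i + eval (A *ᵥ x) p * (A *ᵥ q) i := by
      generalize A *ᵥ x = x'
      generalize A *ᵥ q = q'
      simp only [dirD, pderiv_mul, map_add, map_mul, eval_X, pderiv_X]
      fin_cases i <;> simp [Fin.sum_univ_three, Pi.single_apply] <;> ring
    rw [e1, e2, hp, eval_substPoly]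

lemma dirD_smul (F : MvPolynomial (Fin 3) K) (c : K) (x q : Fin 3 → K) :
    dirD (c • F) x q = c * dirD F x q := by
  simp [dirD, Finset.mul_sum, mul_left_comm]

lemma eval_smul_hom {n : ℕ} {F : MvPolynomial (Fin 3) K} (h : F.IsHomogeneous n) (t : K)
    (x : Fin 3 → K) : eval (t • x) F = t ^ n * eval x F := by
  rw [eval_eq', eval_eq', Finset.mul_sum]
  refine Finset.sum_congr rfl fun m hm => ?_
  have hm' := h (mem_support_iff.mp hm)
  rw [Finsupp.weight_apply, Finsupp.sum_fintype _ _ (by simp)] at hm'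
  simp only [Pi.smul_apply, smul_eq_mul, mul_pow, Finset.prod_mul_distrib,
    Finset.prod_pow_eq_pow_sum]
  simp at hm'
  rw [hm']; ring

lemma substPoly_isHomogeneous {n : ℕ} {F : MvPolynomial (Fin 3) K} (h : F.IsHomogeneous n)
    (A : Matrix (Fin 3) (Fin 3) K) : (substPoly A F).IsHomogeneous n := by
  have := h.aeval (φ := F) (g := fun i => (∑ j, A i j • X j : MvPolynomial (Fin 3) K)) (n := 1) ?_
  · simpa [substPoly] using this
  · intro i
    refine IsHomogeneous.sum _ _ _ fun j _ => ?_
    rw [smul_eq_C_mul]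
    simpa using (isHomogeneous_C (Fin 3) (A i j)).mul (isHomogeneous_X K j)

lemma dirD_single (F : MvPolynomial (Fin 3) K) (x : Fin 3 → K) (i : Fin 3) :
    dirD F x (Pi.single i 1) = eval x (pderiv i F) := by
  simp [dirD, Pi.single_apply]

lemma nonsing_subst {F : MvPolynomial (Fin 3) K} (h : IsNonsingular F)
    (A : GL (Fin 3) K) : IsNonsingular (substPoly (A : Matrix (Fin 3) (Fin 3) K) F) := by
  intro x hx
  have hd : ∀ q, dirD (substPoly (A : Matrix (Fin 3) (Fin 3) K) F) x q = 0 := by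
    intro q; simp [dirD, hx]
  have h1 : (A : Matrix (Fin 3) (Fin 3) K) *ᵥ x = 0 := by
    apply h
    intro i
    rw [← dirD_single]
    have := hd (((A⁻¹ : GL (Fin 3) K) : Matrix (Fin 3) (Fin 3) K) *ᵥ (Pi.single i 1))
    rw [dirD_substPoly, Matrix.mulVec_mulVec] at this
    have h2 : (A : Matrix (Fin 3) (Fin 3) K) * ((A⁻¹ : GL (Fin 3) K) : Matrix (Fin 3) (Fin 3) K)
      = 1 := by exact_mod_cast Units.mul_inv A
    rwa [h2, Matrix.one_mulVec] at this
  have h3 : ((A⁻¹ : GL (Fin 3) K) : Matrix (Fin 3) (Fin 3) K) * (A : Matrix (Fin 3) (Fin 3) K)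
      = 1 := by exact_mod_cast Units.inv_mul A
  rw [← Matrix.one_mulVec x, ← h3, ← Matrix.mulVec_mulVec, h1, Matrix.mulVec_zero]

lemma univ_aux [CharZero K] (N : ℕ) (hN : 3 ≤ N) (u e s m p l q : K) (hu : u ≠ 0)
    (h : ∀ t : K, u * t ^ (N + 1) + e * t ^ N + s = (m * t + p) * (l * t + q) ^ N) : s = 0 := by
  have hp : (Polynomial.C u * Polynomial.X ^ (N + 1) + Polynomial.C e * Polynomial.X ^ N + Polynomial.C s : Polynomial K) = (Polynomial.C m * Polynomial.X + Polynomial.C p) * (Polynomial.C l * Polynomial.X + Polynomial.C q) ^ N := by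
    apply Polynomial.funext
    intro t
    simpa using h t
  by_cases hl : l = 0
  · exfalso
    subst hl
    have := congrArg (fun f => f.coeff (N + 1)) hp
    obtain ⟨N, rfl⟩ : ∃ k, N = k + 3 := ⟨N - 3, by omega⟩
    simp only [map_zero, zero_mul, zero_add, ← map_pow, add_mul, mul_assoc] at this
    simp [-map_pow, Polynomial.coeff_X_pow] at this
    exact hu this
  by_cases hq : q = 0
  · subst hq
    have := h 0
    simpa [show N ≠ 0 by omega] using this
  exfalso
  set t₀ := -q / l with ht
  have ht0 : t₀ ≠ 0 := by rw [ht]; exact div_ne_zero (neg_ne_zero.mpr hq) hl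
  have hroot : l * t₀ + q = 0 := by rw [ht]; field_simp; ring
  have hd : (Polynomial.C l * Polynomial.X + Polynomial.C q) ^ 3 ∣ (Polynomial.C u * Polynomial.X ^ (N + 1) + Polynomial.C e * Polynomial.X ^ N + Polynomial.C s : Polynomial K) := by
    rw [hp]; exact Dvd.dvd.mul_left (pow_dvd_pow _ hN) _
  have d1 := Polynomial.pow_sub_dvd_iterate_derivative_of_pow_dvd 1 hd
  have d2 := Polynomial.pow_sub_dvd_iterate_derivative_of_pow_dvd 2 hd
  obtain ⟨g1, hg1⟩ := d1
  obtain ⟨g2, hg2⟩ := d2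
  have e1 := congrArg (Polynomial.eval t₀) hg1
  have e2 := congrArg (Polynomial.eval t₀) hg2
  obtain ⟨N, rfl⟩ : ∃ k, N = k + 3 := ⟨N - 3, by omega⟩
  simp [hroot] at e1 e2
  have e1' : t₀ ^ (N + 2) * (u * (N + 4) * t₀ + e * (N + 3)) = 0 := by
    rw [← e1]; ring
  have e1'' : u * (N + 4) * t₀ + e * (N + 3) = 0 := by
    rcases mul_eq_zero.mp e1' with h | h
    · exact absurd h (pow_ne_zero _ ht0)
    · exact h
  have e2' : t₀ ^ (N + 2) * (u * (N + 4)) = 0 := by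
    linear_combination e2 - (N + 2) * t₀ ^ (N + 1) * e1''
  have h4 : (N : K) + 4 ≠ 0 := by exact_mod_cast (by omega : N + 4 ≠ 0)
  exact (mul_ne_zero (pow_ne_zero _ ht0) (mul_ne_zero hu h4)) e2'



/-- the normal form -/
def nform (d ℓ : ℕ) (α : K) (β : ℕ → K) : MvPolynomial (Fin 3) K :=
  X 0 ^ d + X 1 ^ d + C α * X 0 * X 2 ^ (d - 1) +
        ∑ k ∈ (Finset.Icc 1 d).filter (fun k => 2 ≤ ℓ * k ∧ ℓ * k ≤ d - 2),
          C (β k) * X 0 ^ (d - ℓ * k) * X 1 ^ (ℓ * k)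

lemma eval_nform (d ℓ : ℕ) (α : K) (β : ℕ → K) (x : Fin 3 → K) :
    eval x (nform d ℓ α β) = x 0 ^ d + x 1 ^ d + α * x 0 * x 2 ^ (d - 1) +
        ∑ k ∈ (Finset.Icc 1 d).filter (fun k => 2 ≤ ℓ * k ∧ ℓ * k ≤ d - 2),
          β k * x 0 ^ (d - ℓ * k) * x 1 ^ (ℓ * k) := by
  simp [nform]

lemma pd0_nform (d ℓ : ℕ) (α : K) (β : ℕ → K) (x : Fin 3 → K) :
    eval x (pderiv 0 (nform d ℓ α β)) = d * x 0 ^ (d - 1) + α * x 2 ^ (d - 1) +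
        ∑ k ∈ (Finset.Icc 1 d).filter (fun k => 2 ≤ ℓ * k ∧ ℓ * k ≤ d - 2),
          β k * ((d - ℓ * k : ℕ) * x 0 ^ (d - ℓ * k - 1)) * x 1 ^ (ℓ * k) := by
  simp [nform, pderiv_X]
  rw [mul_comm α]
  congr 1
  refine Finset.sum_congr rfl fun k _ => ?_
  ring

lemma pd1_nform (d ℓ : ℕ) (α : K) (β : ℕ → K) (x : Fin 3 → K) :
    eval x (pderiv 1 (nform d ℓ α β)) = d * x 1 ^ (d - 1) +
        ∑ k ∈ (Finset.Icc 1 d).filter (fun k => 2 ≤ ℓ * k ∧ ℓ * k ≤ d - 2),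
          β k * x 0 ^ (d - ℓ * k) * ((ℓ * k : ℕ) * x 1 ^ (ℓ * k - 1)) := by
  simp [nform, pderiv_X]

lemma pd2_nform (d ℓ : ℕ) (α : K) (β : ℕ → K) (x : Fin 3 → K) :
    eval x (pderiv 2 (nform d ℓ α β)) = α * x 0 * ((d - 1 : ℕ) * x 2 ^ (d - 2)) := by
  simp [nform, pderiv_X]
  left; left; congr 1


lemma eval_nform_zero (d ℓ : ℕ) (hd : 5 ≤ d) (α : K) (β : ℕ → K) (y z : K) : eval ![0, y, z] (nform d ℓ α β) = y ^ d := by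
  rw [eval_nform]
  rw [Finset.sum_eq_zero]
  · simp [show d ≠ 0 by omega]
  · intro k hk
    simp at hk
    simp [show d - ℓ * k ≠ 0 by omega]

lemma pd0_nform_zero (d ℓ : ℕ) (hd : 5 ≤ d) (α : K) (β : ℕ → K) (y z : K) : eval ![0, y, z] (pderiv 0 (nform d ℓ α β)) = α * z ^ (d - 1) := by
  rw [pd0_nform]
  rw [Finset.sum_eq_zero]
  · simp [show d - 1 ≠ 0 by omega]
  · intro k hk
    simp at hk
    simp [show d - ℓ * k - 1 ≠ 0 by omega]

lemma pd1_nform_zero (d ℓ : ℕ) (hd : 5 ≤ d) (α : K) (β : ℕ → K) (y z : K) : eval ![0, y, z] (pderiv 1 (nform d ℓ α β)) = d * y ^ (d - 1) := by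
  rw [pd1_nform]
  rw [Finset.sum_eq_zero]
  · simp
  · intro k hk
    simp at hk
    simp [show d - ℓ * k ≠ 0 by omega]

lemma pd0_nform_one (d ℓ : ℕ) (hd : 5 ≤ d) (α : K) (β : ℕ → K) : eval ![1, 0, 0] (pderiv 0 (nform d ℓ α β)) = d := by
  rw [pd0_nform]
  rw [Finset.sum_eq_zero]
  · simp [show d - 1 ≠ 0 by omega]
  · intro k hk
    simp at hk
    have : ℓ * k ≠ 0 := by omega
    simp at this
    simp [this]

lemma eval_nform_one (d ℓ : ℕ) (hd : 5 ≤ d) (α : K) (β : ℕ → K) : eval ![1, 0, 0] (nform d ℓ α β) = 1 := by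
  rw [eval_nform]
  rw [Finset.sum_eq_zero]
  · simp [show d - 1 ≠ 0 by omega, show d ≠ 0 by omega]
  · intro k hk
    simp at hk
    have : ℓ * k ≠ 0 := by omega
    simp at this
    simp [this]

lemma aut_nform_diag [CharZero K] (d ℓ : ℕ) (hd : 5 ≤ d) (α : K) (hα : α ≠ 0) (β : ℕ → K) (A : Matrix (Fin 3) (Fin 3) K) (hA : IsUnit A) (c : K)
    (hc : substPoly A (nform d ℓ α β) = c • nform d ℓ α β) :
    A 0 1 = 0 ∧ A 0 2 = 0 ∧ A 1 0 = 0 ∧ A 1 2 = 0 ∧ A 2 0 = 0 ∧ A 2 1 = 0 ∧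
    A 0 0 ^ d = c ∧ A 1 1 ^ d = c ∧ A 0 0 * A 2 2 ^ (d - 1) = c ∧ A 2 2 ≠ 0 ∧ A 1 1 ≠ 0 := by
  set G := nform d ℓ α β with hG
  have hd0 : (d : K) ≠ 0 := by exact_mod_cast (by omega : d ≠ 0)
  have hd1 : ((d - 1 : ℕ) : K) ≠ 0 := by exact_mod_cast (by omega : d - 1 ≠ 0)
  have hev : ∀ x, eval (A *ᵥ x) G = c * eval x G := by
    intro x; rw [← eval_substPoly, hc]; simp
  have hdir : ∀ x q, dirD G (A *ᵥ x) (A *ᵥ q) = c * dirD G x q := by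
    intro x q; rw [← dirD_substPoly, hc, dirD_smul]
  obtain ⟨⟨A', B, hAB, hBA⟩, rfl⟩ := hA
  change substPoly A' G = c • G at hc
  change ∀ x, eval (A' *ᵥ x) G = c * eval x G at hev
  change ∀ x q, dirD G (A' *ᵥ x) (A' *ᵥ q) = c * dirD G x q at hdir
  simp only
  have hAv : ∀ x, A' *ᵥ x = ![A' 0 0 * x 0 + A' 0 1 * x 1 + A' 0 2 * x 2,
      A' 1 0 * x 0 + A' 1 1 * x 1 + A' 1 2 * x 2, A' 2 0 * x 0 + A' 2 1 * x 1 + A' 2 2 * x 2] := by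
    intro x
    ext i; fin_cases i <;> simp [Matrix.mulVec, dotProduct, Fin.sum_univ_three]
  have hP := hev ![0, 0, 1]
  rw [hG, eval_nform_zero d ℓ hd α β] at hP
  simp [hAv, show d ≠ 0 by omega] at hP
  -- the polar with respect to the image of P
  have hpol : ∀ x, dirD G x ![A' 0 2, A' 1 2, A' 2 2] =
      c * (α * (B *ᵥ x) 0 * ((d - 1 : ℕ) * (B *ᵥ x) 2 ^ (d - 2))) := by
    intro x
    have h1 := hdir (B *ᵥ x) ![0, 0, 1]
    rw [Matrix.mulVec_mulVec, hAB, Matrix.one_mulVec] at h1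
    have e : A' *ᵥ ![0, 0, 1] = ![A' 0 2, A' 1 2, A' 2 2] := by simp [hAv]
    rw [e] at h1
    rw [h1]
    congr 1
    rw [← pd2_nform d ℓ α β]
    simp [dirD, Fin.sum_univ_three, hG]
  have h02 : A' 0 2 = 0 := by
    by_contra hu
    have key : ∀ x y, A' 0 2 * eval ![x, y, 0] (pderiv 0 G) + A' 1 2 * eval ![x, y, 0] (pderiv 1 G) = 0 := by
      intro x y
      refine univ_aux (d - 2) (by omega) (A' 0 2 * α) (A' 2 2 * α * x * (d - 1 : ℕ)) _
        (c * α * (d - 1 : ℕ) * B 0 2) (c * α * (d - 1 : ℕ) * (B 0 0 * x + B 0 1 * y))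
        (B 2 2) (B 2 0 * x + B 2 1 * y) (mul_ne_zero hu hα) fun t => ?_
      have := hpol ![x, y, t]
      have hBv : ∀ i, (B *ᵥ ![x, y, t]) i = B i 2 * t + (B i 0 * x + B i 1 * y) := by
        intro i; simp [Matrix.mulVec, dotProduct, Fin.sum_univ_three]; ring
      rw [hBv, hBv] at this
      simp only [dirD, Fin.sum_univ_three, hG, pd0_nform, pd1_nform, pd2_nform] at this
      simp only [hG, pd0_nform, pd1_nform]
      simp at this ⊢
      obtain ⟨e, rfl⟩ : ∃ e, d = e + 5 := ⟨d - 5, by omega⟩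
      simp at this ⊢
      linear_combination this
    have k1 := key 0 1
    rw [hG, pd0_nform_zero d ℓ hd α β, pd1_nform_zero d ℓ hd α β] at k1
    simp [hd0, show d - 1 ≠ 0 by omega] at k1
    have k2 := key 1 0
    rw [k1, hG, pd0_nform_one d ℓ hd α β] at k2
    simp [hd0, hu] at k2
  have h12 : A' 1 2 = 0 := by
    have : A' *ᵥ ![0, 0, 1] = ![0, A' 1 2, A' 2 2] := by simp [hAv, h02]
    have hP := hev ![0, 0, 1]
    rw [this, hG, eval_nform_zero d ℓ hd α β, eval_nform_zero d ℓ hd α β] at hP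
    simpa [show d ≠ 0 by omega] using hP
  have hdet : IsUnit A'.det := by
    have := congrArg Matrix.det hAB
    rw [Matrix.det_mul, Matrix.det_one] at this
    exact IsUnit.of_mul_eq_one _ this
  have hdet0 := hdet.ne_zero
  rw [Matrix.det_fin_three] at hdet0
  simp only [h02, h12] at hdet0
  have h22 : A' 2 2 ≠ 0 := by
    intro h; apply hdet0; rw [h]; ring
  have hz : ∀ x y z, A' 2 2 * ((A' 0 0 * x + A' 0 1 * y) * (A' 2 0 * x + A' 2 1 * y + A' 2 2 * z) ^ (d - 2))
      = c * (x * z ^ (d - 2)) := by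
    intro x y z
    have h1 := hdir ![x, y, z] ![0, 0, 1]
    rw [hAv, hAv] at h1
    simp only [dirD, Fin.sum_univ_three, hG, pd2_nform] at h1
    simp [h02, h12] at h1
    have : α * (d - 1 : ℕ) ≠ 0 := mul_ne_zero hα hd1
    apply mul_left_cancel₀ this
    linear_combination h1
  have h01 : A' 0 1 = 0 := by
    have := hz 0 1 ((1 - A' 2 1) / A' 2 2)
    rw [mul_div_cancel₀ _ h22] at this
    simpa [h22] using this
  have h00 : A' 0 0 ≠ 0 := by
    intro h; apply hdet0; rw [h, h01]; ring
  have h11 : A' 1 1 ≠ 0 := by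
    intro h; apply hdet0; rw [h, h01]; ring
  have h20 : A' 2 0 = 0 := by
    have := hz 1 0 0
    simpa [h22, h00, show d - 2 ≠ 0 by omega] using this
  have h21 : A' 2 1 = 0 := by
    have := hz 1 1 0
    simpa [h22, h00, h20, h01, show d - 2 ≠ 0 by omega] using this
  have h10 : A' 1 0 = 0 := by
    have h1 := hdir ![0, 1, 0] ![1, 0, 0]
    rw [hAv, hAv] at h1
    simp [dirD, Fin.sum_univ_three, hG, h01, h02, h12, h20, h21, pd0_nform_zero d ℓ hd α β,
      pd1_nform_zero d ℓ hd α β, show d - 1 ≠ 0 by omega] at h1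
    rcases h1 with h | h | h
    · exact h
    · omega
    · exact absurd h h11
  refine ⟨h01, h02, h10, h12, h20, h21, ?_, ?_, ?_, h22, h11⟩
  · have h1 := hev ![1, 0, 0]
    have h2 : A' *ᵥ ![1, 0, 0] = A' 0 0 • ![1, 0, 0] := by
      rw [hAv]; simp [h10, h20]
    rw [h2, hG, eval_nform_one d ℓ hd α β] at h1
    rw [← mul_one c, ← h1, eval_nform, Finset.sum_eq_zero]
    · simp [show d ≠ 0 by omega, show d - 1 ≠ 0 by omega]
    · intro k hk
      simp at hk
      have : ℓ * k ≠ 0 := by omega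
      simp at this
      simp [this]
  · have h1 := hev ![0, 1, 0]
    rw [hAv] at h1
    simpa [h01, h21, hG, eval_nform_zero d ℓ hd α β] using h1
  · have h1 := hdir ![0, 0, 1] ![1, 0, 0]
    rw [hAv, hAv] at h1
    simp [dirD, Fin.sum_univ_three, hG, h01, h02, h12, h20, h10, h21, pd0_nform_zero d ℓ hd α β] at h1
    apply mul_left_cancel₀ hα
    linear_combination h1




lemma exists_gen_nform [CharZero K] (d ℓ : ℕ) (hd : 5 ≤ d) (α : K) (hα : α ≠ 0) (β : ℕ → K) :
    ∃ A₀ ∈ autGL (nform d ℓ α β), ∀ A ∈ autGL (nform d ℓ α β), ∃ z : ℤ,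
      (A₀ ^ z)⁻¹ * A ∈ Subgroup.center (GL (Fin 3) K) := by
  have hdiag : ∀ A ∈ autGL (nform d ℓ α β), ∃ c : K,
    A.1 0 1 = 0 ∧ A.1 0 2 = 0 ∧ A.1 1 0 = 0 ∧ A.1 1 2 = 0 ∧ A.1 2 0 = 0 ∧ A.1 2 1 = 0 ∧
    A.1 0 0 ^ d = c ∧ A.1 1 1 ^ d = c ∧ A.1 0 0 * A.1 2 2 ^ (d - 1) = c ∧ A.1 2 2 ≠ 0 ∧
    A.1 1 1 ≠ 0 := by
    rintro A ⟨c, hc⟩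
    exact ⟨c, aut_nform_diag d ℓ hd α hα β A.1 A.isUnit c hc⟩
  have h11 : ∀ A : autGL (nform d ℓ α β), A.1.1 1 1 ≠ 0 := fun A => by
    obtain ⟨c, h⟩ := hdiag A.1 A.2
    exact h.2.2.2.2.2.2.2.2.2.2
  have h22 : ∀ A : autGL (nform d ℓ α β), A.1.1 2 2 ≠ 0 := fun A => by
    obtain ⟨c, h⟩ := hdiag A.1 A.2
    exact h.2.2.2.2.2.2.2.2.2.1
  let φ : autGL (nform d ℓ α β) →* Kˣ := MonoidHom.mk'
    (fun A => Units.mk0 (A.1.1 1 1) (h11 A) / Units.mk0 (A.1.1 2 2) (h22 A)) (by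
      intro A B
      obtain ⟨c, h01, h02, h10, h12, h20, h21, -⟩ := hdiag A.1 A.2
      ext
      have e1 : ((A * B : autGL (nform d ℓ α β)) : GL (Fin 3) K).1 1 1 = A.1.1 1 1 * B.1.1 1 1 := by
        change (A.1.1 * B.1.1) 1 1 = _
        rw [Matrix.mul_apply, Fin.sum_univ_three, h10, h12]; ring
      have e2 : ((A * B : autGL (nform d ℓ α β)) : GL (Fin 3) K).1 2 2 = A.1.1 2 2 * B.1.1 2 2 := by
        change (A.1.1 * B.1.1) 2 2 = _
        rw [Matrix.mul_apply, Fin.sum_univ_three, h20, h21]; ring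
      simp only [Units.val_div_eq_div_val, Units.val_mul, Units.val_mk0, e1, e2]
      rw [mul_div_mul_comm])
  have hφ : ∀ A : autGL (nform d ℓ α β), ((φ A : Kˣ) : K) = A.1.1 1 1 / A.1.1 2 2 := by
    intro A; simp [φ]
  have ha : ∀ A : autGL (nform d ℓ α β), A.1.1 0 0 / A.1.1 2 2 = ((φ A : Kˣ) : K) ^ d := by
    intro A
    obtain ⟨c, -, -, -, -, -, -, e0, e1, e2, -⟩ := hdiag A.1 A.2
    have := h22 A
    rw [hφ, div_pow, e1, ← e2, div_eq_div_iff this (pow_ne_zero _ this)]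
    obtain ⟨e, rfl⟩ : ∃ e, d = e + 5 := ⟨d - 5, by omega⟩
    simp only [show e + 5 - 1 = e + 4 by omega]
    ring
  have hroot : φ.range ≤ rootsOfUnity (d * (d - 1)) K := by
    rintro _ ⟨A, rfl⟩
    rw [mem_rootsOfUnity]
    ext
    rw [Units.val_pow_eq_pow_val, Units.val_one, pow_mul, ← ha]
    obtain ⟨c, -, -, -, -, -, -, e0, e1, e2, -⟩ := hdiag A.1 A.2
    have := h22 A
    have h00 : A.1.1 0 0 ≠ 0 := by
      intro h
      apply h11 A
      rw [h, zero_pow (by omega), ← e1] at e0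
      exact pow_eq_zero_iff (by omega) |>.mp e0.symm
    rw [div_pow, div_eq_one_iff_eq (pow_ne_zero _ this)]
    apply mul_left_cancel₀ h00
    rw [e2, ← e0, ← pow_succ', Nat.sub_add_cancel (by omega)]
  have : NeZero (d * (d - 1)) := ⟨Nat.mul_ne_zero (by omega) (by omega)⟩
  have hcyc : IsCyclic φ.range := Subgroup.isCyclic_of_le hroot
  obtain ⟨⟨_, A₀, rfl⟩, hg⟩ := hcyc.exists_generator
  refine ⟨A₀.1, A₀.2, fun A hA => ?_⟩
  obtain ⟨z, hz⟩ := hg ⟨φ ⟨A, hA⟩, ⟨A, hA⟩, rfl⟩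
  refine ⟨z, ?_⟩
  have hz' : φ A₀ ^ z = φ ⟨A, hA⟩ := congrArg Subtype.val hz
  set B : autGL (nform d ℓ α β) := (A₀ ^ z)⁻¹ * ⟨A, hA⟩ with hB
  have hB1 : φ B = 1 := by rw [hB, map_mul, map_inv, map_zpow, hz']; simp
  have hBv : (A₀.1 ^ z)⁻¹ * A = B.1 := by simp [hB]
  rw [hBv, Matrix.GeneralLinearGroup.mem_center_iff_val_mem_range_scalar]
  refine ⟨B.1.1 2 2, ?_⟩
  obtain ⟨c, h01, h02, h10, h12, h20, h21, -⟩ := hdiag B.1 B.2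
  have e0 := ha B
  have e1 := hφ B
  rw [hB1] at e0 e1
  simp only [Units.val_one, one_pow] at e0 e1
  rw [div_eq_one_iff_eq (h22 B)] at e0
  rw [eq_comm, div_eq_one_iff_eq (h22 B)] at e1
  ext i j
  fin_cases i <;> fin_cases j <;> simp [h01, h02, h10, h12, h20, h21, e0, e1]

lemma isCyclic_of_projEquiv [CharZero K] (d ℓ : ℕ) (hd : 5 ≤ d) (α : K) (hα : α ≠ 0) (β : ℕ → K)
    (F : MvPolynomial (Fin 3) K) (h : ProjEquiv F (nform d ℓ α β)) : IsCyclic (projAut F) := by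
  obtain ⟨P, c, hP⟩ := h
  obtain ⟨A₀, hA₀, hgen⟩ := exists_gen_nform d ℓ hd α hα β
  have hcancel : ∀ x : MvPolynomial (Fin 3) K, (c : K)⁻¹ • (c : K) • x = x := fun x => by
    rw [smul_smul, inv_mul_cancel₀ c.ne_zero, one_smul]
  have hPinv : substPoly (P⁻¹ : GL (Fin 3) K).1 (nform d ℓ α β) = (c : K)⁻¹ • F := by
    have : P.1 * (P⁻¹ : GL (Fin 3) K).1 = 1 := by exact_mod_cast Units.mul_inv P
    rw [← hcancel (nform d ℓ α β), ← hP, substPoly_smul, ← substPoly_mul, this, substPoly_one]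
  have t1 : ∀ A ∈ autGL F, P⁻¹ * A * P ∈ autGL (nform d ℓ α β) := by
    rintro A ⟨e, he⟩
    refine ⟨e, ?_⟩
    change substPoly ((P⁻¹ : GL (Fin 3) K).1 * A.1 * P.1) _ = _
    rw [substPoly_mul, substPoly_mul, hPinv, substPoly_smul, substPoly_smul, he, substPoly_smul, hP,
      smul_comm (e : K), hcancel]
  have t2 : ∀ A ∈ autGL (nform d ℓ α β), P * A * P⁻¹ ∈ autGL F := by
    rintro A ⟨e, he⟩
    refine ⟨e, ?_⟩
    change substPoly (P.1 * A.1 * (P⁻¹ : GL (Fin 3) K).1) _ = _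
    rw [substPoly_mul, substPoly_mul, hP, substPoly_smul, substPoly_smul, he, substPoly_smul, hPinv,
      smul_comm (c : K), smul_comm (c : K), hcancel]
  refine ⟨⟨⟨_, P * A₀ * P⁻¹, t2 A₀ hA₀, rfl⟩, ?_⟩⟩
  rintro ⟨_, A, hA, rfl⟩
  obtain ⟨z, hz⟩ := hgen _ (t1 A hA)
  refine ⟨z, Subtype.ext ?_⟩
  change (QuotientGroup.mk' (Subgroup.center (GL (Fin 3) K)) (P * A₀ * P⁻¹)) ^ z =
    QuotientGroup.mk' (Subgroup.center (GL (Fin 3) K)) A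
  rw [← map_zpow, QuotientGroup.mk'_apply, QuotientGroup.mk'_apply, QuotientGroup.eq, conj_zpow]
  have h2 := (inferInstance : (Subgroup.center (GL (Fin 3) K)).Normal).conj_mem _ hz P
  convert h2 using 1
  group



lemma exists_eigen [IsAlgClosed K] [CharZero K] (A : Matrix (Fin 3) (Fin 3) K) (n : ℕ) (hn : n ≠ 0)
    (μ : K) (hμ : μ ≠ 0) (h : A ^ n = Matrix.scalar (Fin 3) μ) :
    ∃ P : GL (Fin 3) K, ∃ a : Fin 3 → K, A * P.1 = P.1 * Matrix.diagonal a := by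
  set f : Module.End K (Fin 3 → K) := Matrix.toLinAlgEquiv' A with hf
  have hss : f.IsSemisimple := by
    refine Module.End.isSemisimple_of_squarefree_aeval_eq_zero (p := Polynomial.X ^ n - Polynomial.C μ) ?_ ?_
    · exact (Polynomial.separable_X_pow_sub_C μ (by exact_mod_cast hn) hμ).squarefree
    · rw [map_sub, map_pow, Polynomial.aeval_X, Polynomial.aeval_C, hf, ← map_pow, h, sub_eq_zero]
      have : (Matrix.scalar (Fin 3) μ : Matrix (Fin 3) (Fin 3) K) = algebraMap K _ μ := rfl
      rw [this, AlgEquiv.commutes]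
  have htop := Module.End.iSup_maxGenEigenspace_eq_top f
  simp_rw [hss.isFinitelySemisimple.maxGenEigenspace_eq_eigenspace] at htop
  have hspan : (⊤ : Submodule K (Fin 3 → K)) ≤ Submodule.span K {v | ∃ μ : K, f v = μ • v} := by
    rw [← htop]
    refine iSup_le fun μ v hv => Submodule.subset_span ⟨μ, ?_⟩
    exact Module.End.mem_eigenspace_iff.mp hv
  let b := Module.Basis.ofSpan hspan
  have hb : ∀ i, ∃ μ : K, f (b i) = μ • b i := fun i =>
    Module.Basis.ofSpan_subset hspan ⟨i, rfl⟩
  have : Finite _ := Module.Finite.finite_basis b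
  have := Fintype.ofFinite ((linearIndepOn_empty K id).extend
    (Set.empty_subset {v : Fin 3 → K | ∃ μ : K, f v = μ • v}))
  have hcard := Module.finrank_eq_card_basis b
  rw [Module.finrank_fin_fun] at hcard
  let e := Fintype.equivFinOfCardEq hcard.symm
  let b' := b.reindex e
  have hb' : ∀ i, ∃ μ : K, f (b' i) = μ • b' i := fun i => by
    simpa [b'] using hb (e.symm i)
  choose a ha using hb'
  let P : Matrix (Fin 3) (Fin 3) K := Matrix.of fun i j => b' j i
  have hP : IsUnit P := by
    rw [← Matrix.linearIndependent_cols_iff_isUnit]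
    exact b'.linearIndependent
  refine ⟨hP.unit, a, ?_⟩
  ext i j
  have := congrFun (ha j) i
  rw [hf, Matrix.toLinAlgEquiv'_apply] at this
  rw [IsUnit.unit_spec, Matrix.mul_diagonal]
  simp only [Matrix.mulVec, dotProduct, Pi.smul_apply, smul_eq_mul] at this
  rw [Matrix.mul_apply]
  simp only [P, Matrix.of_apply]
  rw [this, mul_comm]

lemma coeff_substPoly_diagonal (a : Fin 3 → K) (F : MvPolynomial (Fin 3) K) (m : Fin 3 →₀ ℕ) :
    coeff m (substPoly (Matrix.diagonal a) F) = (a 0 ^ m 0 * a 1 ^ m 1 * a 2 ^ m 2) * coeff m F := by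
  induction F using MvPolynomial.induction_on generalizing m with
  | C r =>
    simp only [substPoly, aeval_C, algebraMap_eq, coeff_C]
    split_ifs with h
    · subst h; simp
    · simp
  | add f g hf hm =>
    have : ∀ p q : MvPolynomial (Fin 3) K, substPoly (Matrix.diagonal a) (p + q) =
      substPoly (Matrix.diagonal a) p + substPoly (Matrix.diagonal a) q := by
      intro p q; simp [substPoly]
    rw [this, coeff_add, coeff_add, hf, mul_add, hm]
  | mul_X f i hp =>
    have h1 : substPoly (Matrix.diagonal a) (f * X i) =
        C (a i) * (substPoly (Matrix.diagonal a) f * X i) := by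
      simp only [substPoly, map_mul, aeval_X, Matrix.diagonal_apply, ite_smul, zero_smul,
        Finset.sum_ite_eq, Finset.mem_univ, if_true, smul_eq_C_mul]
      ring
    rw [h1, coeff_C_mul, coeff_mul_X', coeff_mul_X']
    split_ifs with h
    · rw [hp, ← mul_assoc]
      congr 1
      have hi : m i ≠ 0 := Finsupp.mem_support_iff.mp h
      obtain ⟨t, ht⟩ := Nat.exists_eq_succ_of_ne_zero hi
      fin_cases i <;> simp at ht <;> simp [ht] <;> ring
    · simp

lemma mono_of_invariant {a : Fin 3 → K} {c : K} {G : MvPolynomial (Fin 3) K}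
    (h : substPoly (Matrix.diagonal a) G = c • G) (m : Fin 3 →₀ ℕ) (hm : coeff m G ≠ 0) :
    a 0 ^ m 0 * a 1 ^ m 1 * a 2 ^ m 2 = c := by
  have := congrArg (coeff m) h
  rw [coeff_substPoly_diagonal, coeff_smul, smul_eq_mul] at this
  exact mul_right_cancel₀ hm this

lemma deg_of_hom {d : ℕ} {G : MvPolynomial (Fin 3) K} (h : G.IsHomogeneous d) (m : Fin 3 →₀ ℕ)
    (hm : coeff m G ≠ 0) : m 0 + m 1 + m 2 = d := by
  have hm' := h hm
  rw [Finsupp.weight_apply, Finsupp.sum_fintype _ _ (by simp)] at hm'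
  simpa [Fin.sum_univ_three] using hm'

lemma arith_two {d ℓ : ℕ} (hd : 5 ≤ d) (hℓ : 2 ≤ ℓ) (hdvd : ℓ ∣ d) {i j k : ℕ} (hs : i + j + k = d)
    (h : d * i + j ≡ d [MOD ℓ * (d - 1)]) : (i = 1 ∧ j = 0 ∧ k = d - 1) ∨ (k = 0 ∧ ℓ ∣ j) := by
  have h1 : d * i + j ≡ d [MOD ℓ] := h.of_mul_right _
  have h2 : d * i + j ≡ d [MOD d - 1] := h.of_mul_left _
  have hj : ℓ ∣ j := by
    have : ℓ ∣ d * i + j := (h1.dvd_iff (dvd_refl ℓ)).mpr hdvd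
    exact (Nat.dvd_add_right (Dvd.dvd.mul_right hdvd i)).mp this
  obtain ⟨e, rfl⟩ : ∃ e, d = e + 1 := ⟨d - 1, by omega⟩
  simp only [Nat.add_sub_cancel] at *
  have h3 : i + j ≡ 1 [MOD e] := by
    have e1 : (e + 1) * i + j = e * i + (i + j) := by ring
    rw [e1] at h2
    have a1 : i + j ≡ e * i + (i + j) [MOD e] := by
      simp [Nat.ModEq]
    have a2 : e + 1 ≡ 1 [MOD e] := by simp [Nat.ModEq]
    exact (a1.trans h2).trans a2
  have h4 : i + j = 1 ∨ i + j = e + 1 := by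
    rcases Nat.lt_or_ge (i + j) e with hlt | hge
    · left
      have := Nat.ModEq.eq_of_lt_of_lt h3 hlt (by omega)
      exact this
    · have : i + j = e ∨ i + j = e + 1 := by omega
      rcases this with h | h
      · rw [h] at h3
        simp [Nat.ModEq, Nat.mod_eq_of_lt (show 1 < e by omega)] at h3
      · exact Or.inr h
  rcases h4 with h4 | h4
  · left
    have : j = 0 := by
      rcases Nat.eq_zero_or_pos j with h | h
      · exact h
      · have := Nat.le_of_dvd h hj; omega
    omega
  · right; exact ⟨by omega, hj⟩

lemma arith_seven {d ℓ : ℕ} (hd : 5 ≤ d) (hℓ : 2 ≤ ℓ) (hdvd : ℓ ∣ d) {j k : ℕ} (hs : j + k = d)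
    (h : (d - 1) * j + k ≡ d - 1 [MOD ℓ * (d - 1)]) : False := by
  have hk : d - 1 ∣ k := by
    have h2 : (d - 1) * j + k ≡ d - 1 [MOD d - 1] := h.of_mul_left _
    have : d - 1 ∣ (d - 1) * j + k := (h2.dvd_iff (dvd_refl _)).mpr (dvd_refl _)
    exact (Nat.dvd_add_right (Dvd.intro _ rfl)).mp this
  obtain ⟨q, rfl⟩ := hk
  have e1 : (d - 1) * j + (d - 1) * q = (d - 1) * (j + q) := by ring
  have h3 : j + q ≡ 1 [MOD ℓ] := by
    rw [e1] at h
    apply Nat.ModEq.mul_left_cancel' (c := d - 1) (by omega)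
    rwa [mul_one, mul_comm (d - 1) ℓ]
  have hq : q = 0 ∨ q = 1 := by
    by_contra hq
    have : 2 ≤ q := by omega
    have := Nat.mul_le_mul_left (d - 1) this
    omega
  rcases hq with rfl | rfl
  · simp at hs
    subst hs
    have : ℓ ∣ 1 := (h3.dvd_iff (dvd_refl _)).mp (by simpa using hdvd)
    have := Nat.le_of_dvd one_pos this
    omega
  · have hj : j = 1 := by omega
    subst hj
    have := (Nat.modEq_iff_dvd' (by omega : 1 ≤ 1 + 1)).mp h3.symm
    have := Nat.le_of_dvd (by omega) this
    omega



/-- monomial exponent -/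
def Ex (i j k : ℕ) : Fin 3 →₀ ℕ := Finsupp.single 0 i + Finsupp.single 1 j + Finsupp.single 2 k

lemma Ex_zero (i j k : ℕ) : Ex i j k 0 = i := by simp [Ex]
lemma Ex_one (i j k : ℕ) : Ex i j k 1 = j := by simp [Ex]
lemma Ex_two (i j k : ℕ) : Ex i j k 2 = k := by simp [Ex]

lemma eq_Ex (m : Fin 3 →₀ ℕ) : m = Ex (m 0) (m 1) (m 2) := by
  ext i; fin_cases i <;> simp [Ex_zero, Ex_one, Ex_two]

lemma Ex_inj {i j k i' j' k' : ℕ} (h : Ex i j k = Ex i' j' k') : i = i' ∧ j = j' ∧ k = k' := by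
  refine ⟨?_, ?_, ?_⟩
  · rw [← Ex_zero i j k, h, Ex_zero]
  · rw [← Ex_one i j k, h, Ex_one]
  · rw [← Ex_two i j k, h, Ex_two]

lemma monomial_Ex (i j k : ℕ) (r : K) :
    monomial (Ex i j k) r = C r * X 0 ^ i * X 1 ^ j * X 2 ^ k := by
  rw [monomial_eq, Finsupp.prod_fintype _ _ (by simp), Fin.prod_univ_three, Ex_zero, Ex_one, Ex_two]
  ring

lemma shape {d ℓ : ℕ} (hd : 5 ≤ d) (hℓ : 2 ≤ ℓ) (hdvd : ℓ ∣ d) {G : MvPolynomial (Fin 3) K}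
    (hh : G.IsHomogeneous d)
    (hm : ∀ m, coeff m G ≠ 0 → (m 0 = 1 ∧ m 1 = 0 ∧ m 2 = d - 1) ∨ (m 2 = 0 ∧ ℓ ∣ m 1)) :
    ∃ g₀ g₁ α : K, ∃ β : ℕ → K, G = C g₀ * X 0 ^ d + C g₁ * X 1 ^ d + C α * X 0 * X 2 ^ (d - 1) +
        ∑ k ∈ (Finset.Icc 1 d).filter (fun k => 2 ≤ ℓ * k ∧ ℓ * k ≤ d - 2),
          C (β k) * X 0 ^ (d - ℓ * k) * X 1 ^ (ℓ * k) := by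
  classical
  refine ⟨coeff (Ex d 0 0) G, coeff (Ex 0 d 0) G, coeff (Ex 1 0 (d - 1)) G,
    fun k => coeff (Ex (d - ℓ * k) (ℓ * k) 0) G, ?_⟩
  set T := (Finset.Icc 1 d).filter (fun k => 2 ≤ ℓ * k ∧ ℓ * k ≤ d - 2) with hT
  set I := T.image (fun k => Ex (d - ℓ * k) (ℓ * k) 0) with hI
  have hsub : G.support ⊆ insert (Ex d 0 0) (insert (Ex 0 d 0) (insert (Ex 1 0 (d - 1)) I)) := by
    intro m hmG
    have hc := mem_support_iff.mp hmG
    have hs := deg_of_hom hh m hc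
    simp only [Finset.mem_insert]
    rcases hm m hc with ⟨h0, h1, h2⟩ | ⟨h2, k, hk⟩
    · right; right; left; rw [eq_Ex m, h0, h1, h2]
    · by_cases hk0 : m 1 = 0
      · left; rw [eq_Ex m, hk0, h2]; congr 1; omega
      by_cases hkd : m 1 = d
      · right; left; rw [eq_Ex m, hkd, h2]; congr 1; omega
      right; right; right
      rw [hI, Finset.mem_image]
      refine ⟨k, ?_, ?_⟩
      · rw [hT, Finset.mem_filter, Finset.mem_Icc]
        have hkpos : 1 ≤ k := by
          rcases Nat.eq_zero_or_pos k with h | h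
          · rw [h] at hk; omega
          · exact h
        have hle : k ≤ ℓ * k := Nat.le_mul_of_pos_left k (by omega)
        have h2k : ℓ ≤ ℓ * k := Nat.le_mul_of_pos_right ℓ hkpos
        have hdk : ℓ ∣ d - ℓ * k := Nat.dvd_sub hdvd (Dvd.intro _ rfl)
        have : ℓ ≤ d - ℓ * k := Nat.le_of_dvd (by omega) hdk
        omega
      · conv_rhs => rw [eq_Ex m, h2, hk]
        congr 1; omega
  have hsum : G = ∑ m ∈ insert (Ex d 0 0) (insert (Ex 0 d 0) (insert (Ex 1 0 (d - 1)) I)),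
      monomial m (coeff m G) := by
    conv_lhs => rw [G.as_sum]
    refine Finset.sum_subset hsub fun m _ hm => ?_
    rw [notMem_support_iff.mp hm, monomial_zero]
  have hIm : ∀ m ∈ I, ∃ k, 2 ≤ ℓ * k ∧ ℓ * k ≤ d - 2 ∧ Ex (d - ℓ * k) (ℓ * k) 0 = m := by
    intro m hm
    rw [hI, Finset.mem_image] at hm
    obtain ⟨k, hk, rfl⟩ := hm
    rw [hT, Finset.mem_filter] at hk
    exact ⟨k, hk.2.1, hk.2.2, rfl⟩
  rw [Finset.sum_insert, Finset.sum_insert, Finset.sum_insert, Finset.sum_image] at hsum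
  · conv_lhs => rw [hsum]
    simp only [monomial_Ex]
    simp only [pow_zero, pow_one, mul_one]
    ring
  · intro k _ k' _ h
    have := (Ex_inj h).2.1
    exact Nat.eq_of_mul_eq_mul_left (by omega) this
  · intro h
    obtain ⟨k, _, _, h⟩ := hIm _ h
    have := Ex_inj h
    omega
  · rw [Finset.mem_insert]
    rintro (h | h)
    · have := Ex_inj h
      omega
    · obtain ⟨k, _, _, h⟩ := hIm _ h
      have := Ex_inj h
      omega
  · rw [Finset.mem_insert, Finset.mem_insert]
    rintro (h | h | h)
    · have := Ex_inj h
      omega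
    · have := Ex_inj h
      omega
    · obtain ⟨k, _, _, h⟩ := hIm _ h
      have := Ex_inj h
      omega

lemma diag_unit (s : Fin 3 → K) (hs : ∀ i, s i ≠ 0) : IsUnit (Matrix.diagonal s) := by
  rw [Matrix.isUnit_iff_isUnit_det, Matrix.det_diagonal]
  exact (Finset.prod_ne_zero_iff.mpr fun i _ => hs i).isUnit

lemma exists_nform [IsAlgClosed K] [CharZero K] {d ℓ : ℕ} (hd : 5 ≤ d) (hℓ : 2 ≤ ℓ) (hdvd : ℓ ∣ d)
    {G : MvPolynomial (Fin 3) K} (hh : G.IsHomogeneous d)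
    (hm : ∀ m, coeff m G ≠ 0 → (m 0 = 1 ∧ m 1 = 0 ∧ m 2 = d - 1) ∨ (m 2 = 0 ∧ ℓ ∣ m 1))
    (h0 : eval (Pi.single 0 1) (pderiv 0 G) ≠ 0) (h1 : eval (Pi.single 1 1) (pderiv 1 G) ≠ 0)
    (h2 : eval (Pi.single 2 1) (pderiv 0 G) ≠ 0) :
    ∃ Q : GL (Fin 3) K, ∃ α : K, α ≠ 0 ∧ ∃ β : ℕ → K, substPoly Q.1 G = nform d ℓ α β := by
  obtain ⟨g₀, g₁, α, β, rfl⟩ := shape hd hℓ hdvd hh hm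
  clear hm hh
  have hz0 : ∀ k, 2 ≤ ℓ * k ∧ ℓ * k ≤ d - 2 → ℓ * k ≠ 0 ∧ ℓ * k - 1 ≠ 0 ∧ d - ℓ * k ≠ 0 ∧ d - ℓ * k - 1 ≠ 0 := by
    intro k hk; omega
  have hg0 : g₀ ≠ 0 := by
    rintro rfl
    apply h0
    simp [pderiv_X, show d - 1 ≠ 0 by omega]
    refine Finset.sum_eq_zero fun k hk => ?_
    simp only [Finset.mem_filter] at hk
    rw [zero_pow (hz0 k hk.2).1]; simp
  have hg1 : g₁ ≠ 0 := by
    rintro rfl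
    apply h1
    simp [pderiv_X, show d - 1 ≠ 0 by omega]
    refine Finset.sum_eq_zero fun k hk => ?_
    simp only [Finset.mem_filter] at hk
    rw [zero_pow (hz0 k hk.2).2.2.1]; simp
  have hα : α ≠ 0 := by
    rintro rfl
    apply h2
    simp [pderiv_X, show d - 1 ≠ 0 by omega]
    refine Finset.sum_eq_zero fun k hk => ?_
    simp only [Finset.mem_filter] at hk
    rw [zero_pow (hz0 k hk.2).1]; simp
  obtain ⟨s, hs⟩ := IsAlgClosed.exists_pow_nat_eq g₀⁻¹ (show 0 < d by omega)
  obtain ⟨t, ht⟩ := IsAlgClosed.exists_pow_nat_eq g₁⁻¹ (show 0 < d by omega)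
  have hs0 : s ≠ 0 := by
    rintro rfl
    rw [zero_pow (by omega)] at hs
    exact inv_ne_zero hg0 hs.symm
  have ht0 : t ≠ 0 := by
    rintro rfl
    rw [zero_pow (by omega)] at ht
    exact inv_ne_zero hg1 ht.symm
  have hu := diag_unit ![s, t, 1] (by intro i; fin_cases i <;> simp [hs0, ht0])
  refine ⟨hu.unit, α * s, mul_ne_zero hα hs0, fun k => β k * s ^ (d - ℓ * k) * t ^ (ℓ * k), ?_⟩
  rw [IsUnit.unit_spec]
  have hX : ∀ i, ∑ j, (Matrix.diagonal ![s, t, 1]) i j • (X j : MvPolynomial (Fin 3) K) =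
      C (![s, t, 1] i) * X i := by
    intro i
    simp [Matrix.diagonal_apply, ite_smul, smul_eq_C_mul]
  have e0 : (C g₀ : MvPolynomial (Fin 3) K) * C s ^ d = 1 := by
    rw [← C_pow, hs, ← C_mul, mul_inv_cancel₀ hg0, C_1]
  have e1 : (C g₁ : MvPolynomial (Fin 3) K) * C t ^ d = 1 := by
    rw [← C_pow, ht, ← C_mul, mul_inv_cancel₀ hg1, C_1]
  simp only [substPoly, hX, nform, map_add, map_mul, map_sum, map_pow, aeval_X, aeval_C, algebraMap_eq]
  congr 1
  · simp
    linear_combination X 0 ^ d * e0 + X 1 ^ d * e1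
  · refine Finset.sum_congr rfl fun k _ => ?_
    simp
    ring



lemma const_of_no_zero [IsAlgClosed K] (H : MvPolynomial (Fin 3) K) (v : Fin 3 → Polynomial K)
    (h : ∀ t : K, eval (fun i => (v i).eval t) H ≠ 0) (s t : K) :
    eval (fun i => (v i).eval s) H = eval (fun i => (v i).eval t) H := by
  have he : ∀ t, (aeval v H : Polynomial K).eval t = eval (fun i => (v i).eval t) H := by
    intro t
    have := MvPolynomial.map_aeval v (Polynomial.evalRingHom t) H
    simp only [Polynomial.coe_evalRingHom] at this
    rw [this]
    unfold MvPolynomial.eval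
    congr 1
    ext <;> simp
  have hdeg : (aeval v H : Polynomial K).degree = 0 := by
    by_contra hne
    obtain ⟨r, hr⟩ := IsAlgClosed.exists_root _ hne
    exact h r (by rw [← he]; exact hr)
  rw [← he, ← he, Polynomial.eq_C_of_degree_eq_zero hdeg]
  simp

lemma singular_of_dvd [IsAlgClosed K] [CharZero K] {d : ℕ} (hd : 5 ≤ d)
    {G : MvPolynomial (Fin 3) K} (hh : G.IsHomogeneous d)
    (hm : ∀ m, coeff m G ≠ 0 → m 0 ≠ 0) : ¬ IsNonsingular G := by
  intro hns
  have hdvd : X 0 ∣ G := by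
    rw [G.as_sum]
    refine Finset.dvd_sum fun m hmm => ?_
    rw [X_dvd_monomial]
    exact Or.inr (hm m (mem_support_iff.mp hmm))
  obtain ⟨H, rfl⟩ := hdvd
  have hp := hh.pderiv (i := 0)
  have hf : ∀ y z, eval ![0, y, z] (pderiv 0 (X 0 * H)) = eval ![0, y, z] H := by
    intro y z; simp
  have hhom : ∀ t y z : K, eval ![0, t * y, t * z] H = t ^ (d - 1) * eval ![0, y, z] H := by
    intro t y z
    rw [← hf, ← hf, ← eval_smul_hom hp]
    congr 2
    ext i; fin_cases i <;> simp
  have hnz : ∀ y z : K, (y ≠ 0 ∨ z ≠ 0) → eval ![0, y, z] H ≠ 0 := by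
    intro y z hyz h
    have := hns ![0, y, z] (by
      intro i
      fin_cases i
      · simpa using h
      · simp [pderiv_X]
      · simp [pderiv_X])
    have h1 := congrFun this 1
    have h2 := congrFun this 2
    simp at h1 h2
    rcases hyz with h' | h'
    · exact h' h1
    · exact h' h2
  have c1 : eval ![0, 1, 1] H = eval ![0, 1, 2] H := by
    have e : ∀ t : K, (fun i => (![0, 1, Polynomial.X] i : Polynomial K).eval t) = ![0, 1, t] := by
      intro t; ext i; fin_cases i <;> simp
    have := const_of_no_zero H ![0, 1, Polynomial.X] (by
      intro t; rw [e]; exact hnz _ _ (Or.inl one_ne_zero)) 1 2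
    rwa [e, e] at this
  have c2 : eval ![0, 1, 2] H = eval ![0, 2, 2] H := by
    have e : ∀ t : K, (fun i => (![0, Polynomial.X, 2] i : Polynomial K).eval t) = ![0, t, 2] := by
      intro t; ext i; fin_cases i <;> simp
    have := const_of_no_zero H ![0, Polynomial.X, 2] (by
      intro t; rw [e]; exact hnz _ _ (Or.inr two_ne_zero)) 1 2
    rwa [e, e] at this
  have c3 := hhom 2 1 1
  rw [mul_one, ← c2, ← c1] at c3
  have h11 := hnz 1 1 (Or.inl one_ne_zero)
  have : (2 : K) ^ (d - 1) = 1 := by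
    apply mul_right_cancel₀ h11
    rw [← c3, one_mul]
  have h2 : (2 : ℕ) ^ (d - 1) = 1 := by exact_mod_cast this
  have := Nat.one_lt_two_pow (show d - 1 ≠ 0 by omega)
  omega

/-- diagonalised situation -/
structure Good (d n : ℕ) (G : MvPolynomial (Fin 3) K) (a : Fin 3 → K) (c : K) : Prop where
  hom : G.IsHomogeneous d
  ns : IsNonsingular G
  inv : substPoly (Matrix.diagonal a) G = c • G
  ne : ∀ i, a i ≠ 0
  ord : ∀ (N : ℕ) (μ : K), (∀ i, a i ^ N = μ) → n ∣ N

lemma Good.rel {d n : ℕ} {G : MvPolynomial (Fin 3) K} {a : Fin 3 → K} {c : K}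
    (h : Good d n G a c) (i j : Fin 3) (hij : eval (Pi.single i 1) (pderiv j G) ≠ 0) :
    a i ^ (d - 1) * a j = c := by
  have h1 : dirD (substPoly (Matrix.diagonal a) G) (Pi.single i 1) (Pi.single j 1) =
    c * dirD G (Pi.single i 1) (Pi.single j 1) := by rw [h.inv, dirD_smul]
  have e : ∀ i, Matrix.diagonal a *ᵥ (Pi.single i (1 : K)) = a i • Pi.single i 1 := by
    intro i
    ext k
    by_cases hk : k = i <;> simp [Matrix.mulVec_diagonal, hk]
  rw [dirD_substPoly, e, e] at h1
  have h2 : dirD G (a i • Pi.single i 1) (a j • Pi.single j 1) =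
      a i ^ (d - 1) * a j * dirD G (Pi.single i 1) (Pi.single j 1) := by
    have hlin : dirD G (a i • Pi.single i 1) (a j • Pi.single j 1) =
        a j * eval (a i • Pi.single i 1) (pderiv j G) := by
      rw [← dirD_single]
      simp [dirD, Finset.mul_sum, mul_assoc]
    rw [dirD_single, hlin, eval_smul_hom h.hom.pderiv]
    ring
  rw [h2, dirD_single] at h1
  exact mul_right_cancel₀ hij h1

lemma Good.exists_rel {d n : ℕ} {G : MvPolynomial (Fin 3) K} {a : Fin 3 → K} {c : K}
    (h : Good d n G a c) (i : Fin 3) : ∃ j, eval (Pi.single i 1) (pderiv j G) ≠ 0 := by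
  by_contra! hcon
  have := congrFun (h.ns _ hcon) i
  simp at this

lemma exists_perm (σ : Fin 3 → Fin 3) : ∃ e : Equiv.Perm (Fin 3),
    (σ (e 0) = e 0 ∧ σ (e 1) = e 1 ∧ σ (e 2) = e 2) ∨
    (σ (e 0) = e 0 ∧ σ (e 1) = e 1 ∧ σ (e 2) = e 0) ∨
    (σ (e 0) = e 0 ∧ σ (e 1) = e 0 ∧ σ (e 2) = e 0) ∨
    (σ (e 0) = e 0 ∧ σ (e 1) = e 0 ∧ σ (e 2) = e 1) ∨
    (σ (e 0) = e 0 ∧ σ (e 1) = e 2 ∧ σ (e 2) = e 1) ∨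
    (σ (e 0) = e 1 ∧ σ (e 1) = e 2 ∧ σ (e 2) = e 0) ∨
    (σ (e 0) = e 1 ∧ σ (e 1) = e 0 ∧ σ (e 2) = e 0) := by
  revert σ
  decide

lemma Good.perm {d n : ℕ} {G : MvPolynomial (Fin 3) K} {a : Fin 3 → K} {c : K}
    (h : Good d n G a c) (e : Equiv.Perm (Fin 3)) : ∃ Q : GL (Fin 3) K,
    Good d n (substPoly Q.1 G) (a ∘ e) c ∧ ∀ i j, eval (Pi.single i 1) (pderiv j (substPoly Q.1 G)) =
      eval (Pi.single (e i) 1) (pderiv (e j) G) := by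
  have hu : IsUnit ((1 : Matrix (Fin 3) (Fin 3) K).submatrix (Equiv.refl _) e) := by
    rw [Matrix.isUnit_submatrix_equiv]; exact isUnit_one
  refine ⟨hu.unit, ⟨substPoly_isHomogeneous h.hom _, nonsing_subst h.ns _, ?_, fun i => h.ne _, ?_⟩, ?_⟩
  · rw [← substPoly_mul, IsUnit.unit_spec]
    have : (1 : Matrix (Fin 3) (Fin 3) K).submatrix (Equiv.refl _) e * Matrix.diagonal (a ∘ e) =
        Matrix.diagonal a * (1 : Matrix (Fin 3) (Fin 3) K).submatrix (Equiv.refl _) e := by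
      ext i j
      simp [Matrix.one_apply]
      split_ifs with h
      · rw [h]
      · rfl
    rw [this, substPoly_mul, h.inv, substPoly_smul]
  · intro N μ hN
    refine h.ord N μ fun i => ?_
    simpa using hN (e.symm i)
  · intro i j
    rw [← dirD_single, dirD_substPoly, ← dirD_single, IsUnit.unit_spec]
    congr 1
    · ext k; simp [Matrix.one_apply, Pi.single_apply]
    · ext k; simp [Matrix.one_apply, Pi.single_apply]



lemma cyc_pow {x y z : K} (hx : x ≠ 0) (hy : y ≠ 0) (m : ℕ)
    (h1 : x ^ (m + 1) * y = y ^ (m + 1) * z) (h2 : x ^ (m + 1) * y = z ^ (m + 1) * x) :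
    x ^ (m * (m + 1) + 1) = y ^ (m * (m + 1) + 1) := by
  have e1 : z * y ^ m = x ^ (m + 1) := by
    apply mul_right_cancel₀ hy
    rw [h1]; ring
  have e2 : z ^ (m + 1) * y ^ (m * (m + 1)) = x ^ ((m + 1) * (m + 1)) := by
    rw [pow_mul y, ← mul_pow, e1, ← pow_mul]
  apply mul_left_cancel₀ (pow_ne_zero (m + 1) hx)
  calc x ^ (m + 1) * x ^ (m * (m + 1) + 1) = x ^ ((m + 1) * (m + 1)) * x := by ring
    _ = z ^ (m + 1) * y ^ (m * (m + 1)) * x := by rw [e2]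
    _ = (z ^ (m + 1) * x) * y ^ (m * (m + 1)) := by ring
    _ = (x ^ (m + 1) * y) * y ^ (m * (m + 1)) := by rw [h2]
    _ = x ^ (m + 1) * y ^ (m * (m + 1) + 1) := by ring

lemma modEq_of_pow {w : K} {n E₁ E₂ : ℕ} (hw : w ≠ 0) (hn : ∀ M, w ^ M = 1 → n ∣ M)
    (h : w ^ E₁ = w ^ E₂) : E₁ ≡ E₂ [MOD n] := by
  have h1 : (Units.mk0 w hw) ^ E₁ = (Units.mk0 w hw) ^ E₂ := by ext; simpa using h
  rw [pow_eq_pow_iff_modEq] at h1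
  refine h1.of_dvd (hn _ ?_)
  have := congrArg Units.val (pow_orderOf_eq_one (Units.mk0 w hw))
  rw [Units.val_pow_eq_pow_val, Units.val_mk0, Units.val_one] at this
  exact this

lemma Good.main [IsAlgClosed K] [CharZero K] {d ℓ : ℕ} (hd : 5 ≤ d) (hℓ : 2 ≤ ℓ) (hdvd : ℓ ∣ d)
    {G : MvPolynomial (Fin 3) K} {a : Fin 3 → K} {c : K} (h : Good d (ℓ * (d - 1)) G a c) :
    ∃ Q : GL (Fin 3) K, ∃ α : K, α ≠ 0 ∧ ∃ β : ℕ → K, substPoly Q.1 G = nform d ℓ α β := by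
  choose σ hσ using h.exists_rel
  obtain ⟨e, he⟩ := exists_perm σ
  obtain ⟨R, hR, hRd⟩ := h.perm e
  suffices hs : ∃ Q : GL (Fin 3) K, ∃ α : K, α ≠ 0 ∧ ∃ β : ℕ → K,
      substPoly Q.1 (substPoly R.1 G) = nform d ℓ α β by
    obtain ⟨Q, α, hα, β, hQ⟩ := hs
    refine ⟨R * Q, α, hα, β, ?_⟩
    rw [← hQ, ← substPoly_mul]; rfl
  have hv : ∀ i j, σ (e i) = e j →
      eval (Pi.single i 1) (pderiv j (substPoly R.1 G)) ≠ 0 := by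
    intro i j hij
    rw [hRd, ← hij]; exact hσ _
  clear hσ hRd h
  generalize substPoly R.1 G = G' at *
  generalize a ∘ e = b at *
  have hl1 : ¬ ℓ ∣ 1 := fun h => by have := Nat.le_of_dvd one_pos h; omega
  have hb0 := hR.ne 0
  have hb1 := hR.ne 1
  have hb2 := hR.ne 2
  have hord : ∀ N, b 1 ^ N = b 0 ^ N → b 2 ^ N = b 0 ^ N → ℓ * (d - 1) ∣ N := by
    intro N h1 h2
    refine hR.ord N (b 0 ^ N) fun i => ?_
    fin_cases i
    · rfl
    · exact h1
    · exact h2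
  obtain ⟨m, hm⟩ : ∃ m, d = m + 2 := ⟨d - 2, by omega⟩
  have hm1 : d - 1 = m + 1 := by omega
  have hndvd : ∀ q, ¬ ℓ * (d - 1) ∣ (m + 1) * q + 1 := by
    intro q hq
    have : m + 1 ∣ (m + 1) * q + 1 := by
      rw [hm1] at hq; exact (Dvd.intro_left ℓ rfl).trans hq
    have := (Nat.dvd_add_right (Dvd.intro q rfl)).mp this
    have := Nat.le_of_dvd one_pos this
    omega
  have R' := hR.rel
  rw [hm1] at R'
  rcases he with ⟨h0, h1, h2⟩ | ⟨h0, h1, h2⟩ | ⟨h0, h1, h2⟩ | ⟨h0, h1, h2⟩ | ⟨h0, h1, h2⟩ |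
    ⟨h0, h1, h2⟩ | ⟨h0, h1, h2⟩
  · exfalso
    have r0 := R' _ _ (hv _ _ h0)
    have r1 := R' _ _ (hv _ _ h1)
    have r2 := R' _ _ (hv _ _ h2)
    refine hndvd 1 (hord _ ?_ ?_)
    · rw [mul_one, pow_succ, pow_succ (b 0), r0, r1]
    · rw [mul_one, pow_succ, pow_succ (b 0), r0, r2]
  · have r0 := R' _ _ (hv _ _ h0)
    have r1 := R' _ _ (hv _ _ h1)
    have r2 := R' _ _ (hv _ _ h2)
    refine exists_nform hd hℓ hdvd hR.hom ?_ (hv _ _ h0) (hv _ _ h1) (hv _ _ h2)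
    intro k hk
    have hs := deg_of_hom hR.hom k hk
    have hc := mono_of_invariant hR.inv k hk
    refine arith_two hd hℓ hdvd hs ?_
    have hxw : b 0 / b 2 = (b 1 / b 2) ^ d := by
      rw [div_pow, div_eq_div_iff hb2 (pow_ne_zero _ hb2), hm]
      linear_combination b 2 * (r2 - r1)
    refine modEq_of_pow (div_ne_zero hb1 hb2) ?_ ?_
    · intro M hM
      have e1 : b 1 ^ M = b 2 ^ M := by
        rwa [div_pow, div_eq_one_iff_eq (pow_ne_zero _ hb2)] at hM
      have e0 : b 0 ^ M = b 2 ^ M := by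
        rw [← div_eq_one_iff_eq (pow_ne_zero _ hb2), ← div_pow, hxw, ← pow_mul, mul_comm, pow_mul,
          hM, one_pow]
      exact hord M (e1.trans e0.symm) e0.symm
    · rw [pow_add, pow_mul, ← hxw, div_pow, div_pow, div_mul_div_comm, ← pow_add,
        div_eq_div_iff (pow_ne_zero _ hb2) hb2]
      apply mul_right_cancel₀ (pow_ne_zero (k 2) hb2)
      have e1 : b 0 ^ k 0 * b 1 ^ k 1 * b 2 * b 2 ^ k 2 = c * b 2 := by rw [← hc]; ring
      have e2 : b 0 * b 2 ^ (k 0 + k 1) * b 2 ^ k 2 = c * b 2 := by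
        rw [mul_assoc, ← pow_add, hs, hm, ← r2]; ring
      rw [e1, e2]
  · exfalso
    have r0 := R' _ _ (hv _ _ h0)
    have r1 := R' _ _ (hv _ _ h1)
    have r2 := R' _ _ (hv _ _ h2)
    have := hord (m + 1) (mul_right_cancel₀ hb0 (r1.trans r0.symm))
      (mul_right_cancel₀ hb0 (r2.trans r0.symm))
    have := Nat.le_of_dvd (by omega) this
    have := Nat.mul_le_mul_right (d - 1) hℓ
    omega
  · exfalso
    have r0 := R' _ _ (hv _ _ h0)
    have r1 := R' _ _ (hv _ _ h1)
    have r2 := R' _ _ (hv _ _ h2)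
    have e1 := mul_right_cancel₀ hb0 (r1.trans r0.symm)
    have e2 : b 2 ^ ((m + 1) * (m + 1)) = b 0 ^ ((m + 1) * (m + 1)) := by
      apply mul_right_cancel₀ (pow_ne_zero (m + 1) hb1)
      rw [pow_mul, ← mul_pow, r2, e1, ← r0, pow_mul (b 0), ← mul_pow]
    have := hord ((m + 1) * (m + 1)) (by rw [pow_mul, e1, ← pow_mul]) e2
    rw [hm1] at this
    have h3 : ℓ ∣ m + 1 := Nat.dvd_of_mul_dvd_mul_right (by omega) this
    rw [hm] at hdvd
    exact hl1 ((Nat.dvd_add_right h3).mp hdvd)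
  · exfalso
    have r0 := R' _ _ (hv _ _ h0)
    have r1 := R' _ _ (hv _ _ h1)
    have r2 := R' _ _ (hv _ _ h2)
    have e1 : b 1 ^ m = b 2 ^ m := by
      apply mul_right_cancel₀ (mul_ne_zero hb1 hb2)
      linear_combination r1 - r2
    have e2 : b 1 ^ (m * (m + 2)) = b 0 ^ (m * (m + 2)) := by
      calc b 1 ^ (m * (m + 2)) = (b 1 ^ (m + 1)) ^ m * b 1 ^ m := by ring
        _ = (b 1 ^ (m + 1) * b 2) ^ m := by rw [e1, mul_pow]
        _ = (b 0 ^ (m + 1) * b 0) ^ m := by rw [r1, r0]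
        _ = _ := by ring
    have := hord (m * (m + 2)) e2 (by rw [pow_mul, ← e1, ← pow_mul, e2])
    obtain ⟨q, rfl⟩ : ∃ q, m = q + 1 := ⟨m - 1, by omega⟩
    have h3 : (q + 1) * (q + 1 + 2) + 1 = (q + 1 + 1) * (q + 1 + 1) := by ring
    have h4 : q + 1 + 1 ∣ (q + 1) * (q + 1 + 2) := by
      rw [hm1] at this; exact (Dvd.intro_left ℓ rfl).trans this
    have h5 : q + 1 + 1 ∣ (q + 1) * (q + 1 + 2) + 1 := by rw [h3]; exact Dvd.intro _ rfl
    have := (Nat.dvd_add_right h4).mp h5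
    have := Nat.le_of_dvd one_pos this
    omega
  · exfalso
    have r0 := R' _ _ (hv _ _ h0)
    have r1 := R' _ _ (hv _ _ h1)
    have r2 := R' _ _ (hv _ _ h2)
    have e1 := cyc_pow hb0 hb1 m (r0.trans r1.symm) (r0.trans r2.symm)
    have e2 := cyc_pow hb1 hb2 m (r1.trans r2.symm) (r1.trans r0.symm)
    refine hndvd m ?_
    rw [mul_comm (m + 1)]
    exact hord _ e1.symm (e2.symm.trans e1.symm)
  · exfalso
    have r0 := R' _ _ (hv _ _ h0)
    have r1 := R' _ _ (hv _ _ h1)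
    have r2 := R' _ _ (hv _ _ h2)
    refine singular_of_dvd hd hR.hom ?_ hR.ns
    intro k hk hk0
    have hs := deg_of_hom hR.hom k hk
    have hc := mono_of_invariant hR.inv k hk
    rw [hk0] at hs hc
    rw [zero_add] at hs
    rw [pow_zero, one_mul] at hc
    refine arith_seven hd hℓ hdvd hs ?_
    have hyw : b 1 / b 0 = (b 2 / b 0) ^ (d - 1) := by
      rw [div_pow, div_eq_div_iff hb0 (pow_ne_zero _ hb0), hm1]
      linear_combination r0 - r2
    refine modEq_of_pow (div_ne_zero hb2 hb0) ?_ ?_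
    · intro M hM
      have e2 : b 2 ^ M = b 0 ^ M := by
        rwa [div_pow, div_eq_one_iff_eq (pow_ne_zero _ hb0)] at hM
      have e1 : b 1 ^ M = b 0 ^ M := by
        rw [← div_eq_one_iff_eq (pow_ne_zero _ hb0), ← div_pow, hyw, ← pow_mul, mul_comm, pow_mul,
          hM, one_pow]
      exact hord M e1 e2
    · rw [pow_add, pow_mul, ← hyw, div_pow, div_pow, div_mul_div_comm, ← pow_add, hs, hc,
        div_eq_div_iff (pow_ne_zero _ hb0) hb0, hm, ← r0]
      ring

lemma exists_normal [IsAlgClosed K] [CharZero K]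
    (d ℓ : ℕ) (hd : 5 ≤ d) (hℓ : 2 ≤ ℓ) (hdvd : ℓ ∣ d)
    (F : MvPolynomial (Fin 3) K)
    (hhom : F.IsHomogeneous d) (hns : IsNonsingular F)
    (h : ∃ g ∈ projAut F, orderOf g = ℓ * (d - 1)) :
    ∃ α : K, α ≠ 0 ∧ ∃ β : ℕ → K, ProjEquiv F (nform d ℓ α β) := by
  obtain ⟨_, ⟨A, ⟨c, hc⟩, rfl⟩, hord⟩ := h
  have hn : ℓ * (d - 1) ≠ 0 := Nat.mul_ne_zero (by omega) (by omega)
  have hiff : ∀ N : ℕ, (QuotientGroup.mk' (Subgroup.center (GL (Fin 3) K)) A) ^ N = 1 ↔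
      A.1 ^ N ∈ Set.range (Matrix.scalar (Fin 3)) := by
    intro N
    rw [← map_pow, QuotientGroup.mk'_apply, QuotientGroup.eq_one_iff,
      Matrix.GeneralLinearGroup.mem_center_iff_val_mem_range_scalar]
    rfl
  obtain ⟨μ, hμ⟩ := (hiff (ℓ * (d - 1))).mp (by rw [← hord]; exact pow_orderOf_eq_one _)
  have hμ0 : μ ≠ 0 := by
    rintro rfl
    have h1 : IsUnit (A.1 ^ (ℓ * (d - 1))) := A.isUnit.pow _
    rw [← hμ, map_zero] at h1
    exact not_isUnit_zero h1
  obtain ⟨P, a, hP⟩ := exists_eigen A.1 (ℓ * (d - 1)) hn μ hμ0 hμ.symm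
  have hPi : P.1 * (P⁻¹ : GL (Fin 3) K).1 = 1 := by exact_mod_cast Units.mul_inv P
  have hD : IsUnit (Matrix.diagonal a) := by
    have : Matrix.diagonal a = ((P⁻¹ * A * P : GL (Fin 3) K) : Matrix (Fin 3) (Fin 3) K) := by
      change _ = (P⁻¹ : GL (Fin 3) K).1 * A.1 * P.1
      have hPi' : (P⁻¹ : GL (Fin 3) K).1 * P.1 = 1 := by exact_mod_cast Units.inv_mul P
      rw [Matrix.mul_assoc, hP, ← Matrix.mul_assoc, hPi', Matrix.one_mul]
    rw [this]; exact Units.isUnit _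
  have hpow : ∀ N, A.1 ^ N * P.1 = P.1 * Matrix.diagonal a ^ N := by
    intro N
    induction N with
    | zero => simp
    | succ N ih => rw [pow_succ, Matrix.mul_assoc, hP, ← Matrix.mul_assoc, ih, pow_succ, Matrix.mul_assoc]
  have hgood : Good d (ℓ * (d - 1)) (substPoly P.1 F) a c := by
    refine ⟨substPoly_isHomogeneous hhom _, nonsing_subst hns P, ?_, ?_, ?_⟩
    · rw [← substPoly_mul, ← hP, substPoly_mul, hc, substPoly_smul]
    · rw [Matrix.isUnit_iff_isUnit_det, Matrix.det_diagonal] at hD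
      exact fun i => Finset.prod_ne_zero_iff.mp hD.ne_zero i (Finset.mem_univ i)
    · intro N ν hN
      rw [← hord]
      apply orderOf_dvd_of_pow_eq_one
      rw [hiff]
      refine ⟨ν, ?_⟩
      have h1 : Matrix.diagonal a ^ N = Matrix.scalar (Fin 3) ν := by
        rw [Matrix.diagonal_pow]
        change _ = Matrix.diagonal _
        congr 1
        ext i; exact hN i
      have h2 := hpow N
      rw [h1, ← (Matrix.scalar_commute ν (fun r' => Commute.all _ _) P.1).eq] at h2
      have h3 := congrArg (fun M => M * (P⁻¹ : GL (Fin 3) K).1) h2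
      simp only [Matrix.mul_assoc, hPi, Matrix.mul_one] at h3
      exact h3.symm
  obtain ⟨Q, α, hα, β, hQ⟩ := hgood.main hd hℓ hdvd
  refine ⟨α, hα, β, P * Q, 1, ?_⟩
  rw [Units.val_one, one_smul, ← hQ, ← substPoly_mul]; rfl


/-- for `d ≥ 5` and `ℓ ≥ 2` dividing `d`, a nonsingular plane curve of
degree `d` with an automorphism of order `ℓ(d-1)` is projectively equivalent to
`X^d + Y^d + α·X·Z^(d-1) + Σ_k β_k·X^(d-ℓk)·Y^(ℓk)` (sum over `k ≥ 1` with
`2 ≤ ℓk ≤ d-2`); in particular its automorphism group is cyclic. -/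
theorem stmt10 {K : Type*} [Field K] [IsAlgClosed K] [CharZero K]
    (d ℓ : ℕ) (hd : 5 ≤ d) (hℓ : 2 ≤ ℓ) (hdvd : ℓ ∣ d)
    (F : MvPolynomial (Fin 3) K)
    (hhom : F.IsHomogeneous d) (hns : IsNonsingular F)
    (h : ∃ g ∈ projAut F, orderOf g = ℓ * (d - 1)) :
    (∃ α : K, α ≠ 0 ∧ ∃ β : ℕ → K,
      ProjEquiv F (X 0 ^ d + X 1 ^ d + C α * X 0 * X 2 ^ (d - 1) +
        ∑ k ∈ (Finset.Icc 1 d).filter (fun k => 2 ≤ ℓ * k ∧ ℓ * k ≤ d - 2),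
          C (β k) * X 0 ^ (d - ℓ * k) * X 1 ^ (ℓ * k))) ∧
    IsCyclic ↥(projAut F) := by
  obtain ⟨α, hα, β, hE⟩ := exists_normal d ℓ hd hℓ hdvd F hhom hns h
  exact ⟨⟨α, hα, β, hE⟩, isCyclic_of_projEquiv d ℓ hd α hα β F hE⟩

end
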